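/- arXiv:2110.04058 — 3 statements merged into one kernel-verified Lean document; each statement's English description precedes it below -/
import Mathlib

section
/- Let G = Θ(l_1, …, l_n) be a Generalized Theta graph. For any m ≥ 3, if P(G,m) = ⌈ m² · Π_{i=1}^{n} ( ( ((m−1)^{l_i} + (−1)^{l_i}(m−1)) / ((m−1)^{l_i} − (−1)^{l_i}) )^{1/m} · ((m−1)^{l_i} − (−1)^{l_i})/m ) ⌉, then P_DP(G,m) = P(G,m). -/
open Finset

/-- An `m`-fold cover `𝓗 = (L, H)` of `G`, represented (up to isomorphism) on the vertex set
`V × Fin m`, with `L v = {v} × Fin m`.  The fields record that each part `L v` induces a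
clique in `H`, that cross-edges occur only over edges of `G`, and that the cross-edges
between two parts form a (possibly empty) matching. -/
structure DPCover {V : Type*} (G : SimpleGraph V) (m : ℕ) where
  H : SimpleGraph (V × Fin m)
  fiber_clique : ∀ (v : V) (a b : Fin m), a ≠ b → H.Adj (v, a) (v, b)
  cross_only_edges : ∀ (u v : V) (a b : Fin m), u ≠ v → H.Adj (u, a) (v, b) → G.Adj u v
  cross_matching : ∀ (u v : V), u ≠ v → ∀ (a b b' : Fin m),
    H.Adj (u, a) (v, b) → H.Adj (u, a) (v, b') → b = b'

/-- A full `m`-fold cover: every matching between `L u` and `L v` for `uv ∈ E(G)` is perfect. -/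
def DPCover.IsFull {V : Type*} {G : SimpleGraph V} {m : ℕ} (C : DPCover G m) : Prop :=
  ∀ (u v : V), G.Adj u v → ∀ a : Fin m, ∃ b : Fin m, C.H.Adj (u, a) (v, b)

/-- `P_DP(G, 𝓗)`: the number of `𝓗`-colorings of `G`, i.e. of independent sets in `H` of size
`|V(G)|` (equivalently, of independent transversals of the parts `L v`). -/
noncomputable def DPCover.count {V : Type*} {G : SimpleGraph V} {m : ℕ} (C : DPCover G m) : ℕ :=
  Nat.card {c : V → Fin m // ∀ u v : V, u ≠ v → ¬ C.H.Adj (u, c u) (v, c v)}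

/-- The DP color function `P_DP(G, m)`: the minimum of `P_DP(G, 𝓗)` over all
`m`-fold covers `𝓗` of `G`. -/
noncomputable def PDP {V : Type*} (G : SimpleGraph V) (m : ℕ) : ℕ :=
  sInf (Set.range fun C : DPCover G m => C.count)

/-- The dual DP color function `P*_DP(G, m)`: the maximum of `P_DP(G, 𝓗)` over all full
`m`-fold covers `𝓗` of `G`. -/
noncomputable def PDPdual {V : Type*} (G : SimpleGraph V) (m : ℕ) : ℕ :=
  sSup {k : ℕ | ∃ C : DPCover G m, C.IsFull ∧ C.count = k}

/-- The chromatic polynomial `P(G, m)`: the number of proper colorings of `G` with colors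
from `{1, …, m}`. -/
noncomputable def chromP {V : Type*} (G : SimpleGraph V) (m : ℕ) : ℕ :=
  Nat.card {c : V → Fin m // ∀ u v : V, G.Adj u v → c u ≠ c v}

/-- Vertices of the generalized theta graph `Θ(l 0, …, l (n-1))`: two end vertices
`u = Sum.inl false` and `w = Sum.inl true`, and internal vertices `(i, j)` with
`j ∈ {0, …, l i - 2}` for the `i`-th path (listed along the path from `u` to `w`). -/
abbrev ThetaV {n : ℕ} (l : Fin n → ℕ) : Type :=
  Bool ⊕ (Σ i : Fin n, Fin (l i - 1))

/-- The relation generating the edges of the generalized theta graph. -/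
def thetaRel {n : ℕ} (l : Fin n → ℕ) : ThetaV l → ThetaV l → Prop
  | Sum.inl _, Sum.inl _ => ∃ i, l i = 1
  | Sum.inl a, Sum.inr ⟨i, j⟩ => (a = false ∧ (j : ℕ) = 0) ∨ (a = true ∧ (j : ℕ) = l i - 2)
  | Sum.inr _, Sum.inl _ => False
  | Sum.inr ⟨i, j⟩, Sum.inr ⟨i', j'⟩ => i = i' ∧ (j' : ℕ) = (j : ℕ) + 1

/-- The generalized theta graph `Θ(l 0, …, l (n-1))`: two end vertices `u` and `w` joined by
`n` internally disjoint paths, the `i`-th of length `l i`. -/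
def thetaGraph {n : ℕ} (l : Fin n → ℕ) : SimpleGraph (ThetaV l) :=
  SimpleGraph.fromRel (thetaRel l)

/-- The end vertex `u`. -/
def thetaU {n : ℕ} (l : Fin n → ℕ) : ThetaV l := Sum.inl false

/-- The end vertex `w`. -/
def thetaW {n : ℕ} (l : Fin n → ℕ) : ThetaV l := Sum.inl true

/-- A partial matching between two `m`-element parts of a cover extends to a permutation. -/
theorem DPCover.exists_perm_extending {V : Type*} {G : SimpleGraph V} {m : ℕ} (C : DPCover G m)
    {u v : V} (huv : u ≠ v) :
    ∃ σ : Equiv.Perm (Fin m), ∀ a b, C.H.Adj (u, a) (v, b) → b = σ a := by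
  classical
  set s : Finset (Fin m) := univ.filter fun a => ∃ b, C.H.Adj (u, a) (v, b) with hs
  set f : Fin m → Fin m := fun a =>
    if h : ∃ b, C.H.Adj (u, a) (v, b) then h.choose else a with hf
  have hadj : ∀ a, (∃ b, C.H.Adj (u, a) (v, b)) → C.H.Adj (u, a) (v, f a) := by
    intro a ha
    simp only [hf, dif_pos ha]
    exact ha.choose_spec
  have hinj : Set.InjOn f s := by
    intro a ha a' ha' haa
    have h₁ := hadj a (by simpa [hs] using ha)
    have h₂ := hadj a' (by simpa [hs] using ha')
    rw [← haa] at h₂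
    exact C.cross_matching v u huv.symm _ _ _ h₁.symm h₂.symm
  obtain ⟨g, hg⟩ := Finset.exists_equiv_extend_of_card_eq (t := (univ : Finset (Fin m)))
    (by simp) (Finset.subset_univ _) hinj
  refine ⟨g.trans (Equiv.subtypeUnivEquiv fun _ => Finset.mem_univ _), fun a b hab => ?_⟩
  have h₁ : (g a : Fin m) = f a := hg a (by simpa [hs] using ⟨b, hab⟩)
  have h₂ := C.cross_matching u v huv a b (f a) hab (hadj a ⟨b, hab⟩)
  simp [h₂, h₁]

/-- The sequence `a, x 0, …, x (k - 1), b, b, …`. -/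
def pathSeq {α : Type*} {k : ℕ} (a b : α) (x : Fin k → α) (j : ℕ) : α :=
  if j = 0 then a else if h : j - 1 < k then x ⟨j - 1, h⟩ else b

theorem pathSeq_zero {α : Type*} {k : ℕ} (a b : α) (x : Fin k → α) : pathSeq a b x 0 = a := rfl

theorem pathSeq_cons_succ {α : Type*} {k : ℕ} (a b y : α) (x : Fin k → α) (j : ℕ) :
    pathSeq a b (Fin.cons y x : Fin (k + 1) → α) (j + 1) = pathSeq y b x j := by
  cases j with
  | zero => simp [pathSeq]
  | succ j =>
    by_cases h : j < k
    · simp only [pathSeq, Nat.add_one_sub_one, Nat.add_lt_add_iff_right, h, dif_pos]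
      rfl
    · simp [pathSeq, h]

/-- The colorings of the `k` internal vertices of a path with end colors `a` and `b` in which
the color after position `j` avoids the image under `s j` of the color at position `j`. -/
abbrev PathColoring {m : ℕ} (k : ℕ) (s : ℕ → Equiv.Perm (Fin m)) (a b : Fin m) : Type :=
  {x : Fin k → Fin m // ∀ j < k + 1, pathSeq a b x (j + 1) ≠ s j (pathSeq a b x j)}

/-- Split off the first internal vertex of a path. -/
def pathColoringEquiv {m : ℕ} (k : ℕ) (s : ℕ → Equiv.Perm (Fin m)) (a b : Fin m) :
    PathColoring (k + 1) s a b ≃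
      Σ y : {y : Fin m // y ≠ s 0 a}, PathColoring k (fun j => s (j + 1)) y.1 b where
  toFun x := ⟨⟨x.1 0, by
      have h := x.2 0 (by omega)
      rwa [← Fin.cons_self_tail x.1, pathSeq_cons_succ, pathSeq_zero, pathSeq_zero] at h⟩,
    ⟨Fin.tail x.1, fun j hj => by
      have h := x.2 (j + 1) (by omega)
      rwa [← Fin.cons_self_tail x.1, pathSeq_cons_succ, pathSeq_cons_succ] at h⟩⟩
  invFun p := ⟨Fin.cons p.1.1 p.2.1, fun j hj => by
    cases j with
    | zero => rw [pathSeq_cons_succ]; exact p.1.2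
    | succ j => rw [pathSeq_cons_succ, pathSeq_cons_succ]; exact p.2.2 j (by omega)⟩
  left_inv x := Subtype.ext (Fin.cons_self_tail x.1)
  right_inv p := rfl

theorem exists_perm_card_pathColoring {m : ℕ} (hm : 0 < m) (k : ℕ)
    (s : ℕ → Equiv.Perm (Fin m)) :
    ∃ τ : Equiv.Perm (Fin m), ∀ a b, (Nat.card (PathColoring k s a b) : ℝ) =
      if b = τ a then (((m : ℝ) - 1) ^ (k + 1) + (-1 : ℝ) ^ (k + 1) * ((m : ℝ) - 1)) / m
      else (((m : ℝ) - 1) ^ (k + 1) - (-1 : ℝ) ^ (k + 1)) / m := by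
  have hm0 : (m : ℝ) ≠ 0 := by positivity
  induction k generalizing s with
  | zero =>
    refine ⟨s 0, fun a b => ?_⟩
    by_cases hb : b = s 0 a
    · have : IsEmpty (PathColoring 0 s a b) := ⟨fun x => x.2 0 (by omega) (by simpa [pathSeq])⟩
      rw [if_pos hb, Nat.card_of_isEmpty]
      simp
    · have : Unique (PathColoring 0 s a b) :=
        { default := ⟨Fin.elim0, fun j hj => by
            obtain rfl : j = 0 := by omega
            simpa [pathSeq]⟩
          uniq := fun x => Subtype.ext (Subsingleton.elim _ _) }
      simp [hb, hm0]
  | succ k ih =>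
    obtain ⟨τ, hτ⟩ := ih fun j => s (j + 1)
    refine ⟨(s 0).trans τ, fun a b => ?_⟩
    set A := (((m : ℝ) - 1) ^ (k + 1) + (-1 : ℝ) ^ (k + 1) * ((m : ℝ) - 1)) / m with hA
    set B := (((m : ℝ) - 1) ^ (k + 1) - (-1 : ℝ) ^ (k + 1)) / m with hB
    have hsum : ∑ y : Fin m, (if b = τ y then A else B) = A - B + m * B := by
      have : ∀ y, (if b = τ y then A else B) = (if τ.symm b = y then A - B else 0) + B := by
        intro y
        by_cases h : b = τ y
        · simp [h]
        · rw [if_neg h, if_neg (fun h' => h (by rw [← h', τ.apply_symm_apply]))]; simp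
      simp [this, Finset.sum_add_distrib]
    have hsplit := Fintype.sum_eq_add_sum_subtype_ne (fun y => if b = τ y then A else B) (s 0 a)
    rw [Nat.card_congr (pathColoringEquiv k s a b), Nat.card_sigma]
    push_cast
    simp only [hτ]
    have : ∑ y : {y : Fin m // y ≠ s 0 a}, (if b = τ y then A else B) =
        A - B + m * B - if b = τ (s 0 a) then A else B := by
      rw [← hsum, hsplit]; ring
    rw [this, Equiv.trans_apply]
    by_cases hb : b = τ (s 0 a)
    · rw [if_pos hb, if_pos hb, hA, hB]; field_simp; ring
    · rw [if_neg hb, if_neg hb, hA, hB]; field_simp; ring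

/-- The vertex at position `j` of the `i`-th path, counted from `u` to `w`. -/
def thetaPath {n : ℕ} (l : Fin n → ℕ) (i : Fin n) (j : ℕ) : ThetaV l :=
  pathSeq (Sum.inl false) (Sum.inl true) (fun t : Fin (l i - 1) => Sum.inr ⟨i, t⟩) j

theorem exists_thetaPath_of_thetaRel {n : ℕ} {l : Fin n → ℕ} {u v : ThetaV l} (huv : u ≠ v)
    (h : thetaRel l u v) :
    ∃ i, ∃ j < l i - 1 + 1, (thetaPath l i j = u ∧ thetaPath l i (j + 1) = v) ∨
      (thetaPath l i j = v ∧ thetaPath l i (j + 1) = u) := by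
  rcases u with a | ⟨i, j⟩ <;> rcases v with b | ⟨i', j'⟩
  · obtain ⟨i, hi⟩ := h
    refine ⟨i, 0, by omega, ?_⟩
    cases a <;> cases b <;> simp_all [thetaPath, pathSeq]
  · rcases h with ⟨rfl, h⟩ | ⟨rfl, h⟩
    · refine ⟨i', 0, by omega, Or.inl ⟨rfl, ?_⟩⟩
      have := j'.2
      have h0 : (⟨0, by omega⟩ : Fin (l i' - 1)) = j' := Fin.ext h.symm
      have hpos : 0 < l i' - 1 := by omega
      simp only [thetaPath, pathSeq]
      simp [h0, hpos]
    · have := j'.2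
      refine ⟨i', j' + 1, by omega, Or.inr ⟨?_, ?_⟩⟩
      · simp [thetaPath, pathSeq]
      · have : ¬ (j' : ℕ) + 1 < l i' - 1 := by omega
        simp [thetaPath, pathSeq, this]
  · exact h.elim
  · obtain ⟨rfl, h⟩ := h
    have := j.2
    have := j'.2
    refine ⟨i, j + 1, by omega, Or.inl ⟨?_, ?_⟩⟩
    · simp [thetaPath, pathSeq]
    · simp [thetaPath, pathSeq, ← h]

theorem thetaPath_ne_succ {n : ℕ} (l : Fin n → ℕ) (i : Fin n) {j : ℕ} (hj : j < l i - 1 + 1) :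
    thetaPath l i j ≠ thetaPath l i (j + 1) := by
  simp only [thetaPath, pathSeq]
  split_ifs <;> first | omega | (simp; try omega)

/-- The coloring of the theta graph with given end colors and path colors. -/
def thetaColoring {n : ℕ} {l : Fin n → ℕ} {α : Type*} (a b : α)
    (x : ∀ i, Fin (l i - 1) → α) : ThetaV l → α
  | Sum.inl false => a
  | Sum.inl true => b
  | Sum.inr ⟨i, j⟩ => x i j

theorem thetaColoring_thetaPath {n : ℕ} {l : Fin n → ℕ} {α : Type*} (a b : α)
    (x : ∀ i, Fin (l i - 1) → α) (i : Fin n) (j : ℕ) :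
    thetaColoring a b x (thetaPath l i j) = pathSeq a b (x i) j := by
  simp only [thetaPath, pathSeq]
  split_ifs <;> rfl

theorem exists_perm_sum_prod_le_count {n m : ℕ} (l : Fin n → ℕ) (C : DPCover (thetaGraph l) m) :
    ∃ s : Fin n → ℕ → Equiv.Perm (Fin m),
      ∑ p : Fin m × Fin m, ∏ i, Nat.card (PathColoring (l i - 1) (s i) p.1 p.2) ≤ C.count := by
  classical
  have hperm : ∀ (i : Fin n) (j : ℕ), ∃ σ : Equiv.Perm (Fin m), j < l i - 1 + 1 →
      ∀ a b, C.H.Adj (thetaPath l i j, a) (thetaPath l i (j + 1), b) → b = σ a := by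
    intro i j
    by_cases hj : j < l i - 1 + 1
    · obtain ⟨σ, hσ⟩ := C.exists_perm_extending (thetaPath_ne_succ l i hj)
      exact ⟨σ, fun _ => hσ⟩
    · exact ⟨1, fun h => absurd h hj⟩
  choose s hs using hperm
  refine ⟨s, ?_⟩
  let f : (Σ p : Fin m × Fin m, ∀ i, PathColoring (l i - 1) (s i) p.1 p.2) →
      {c : ThetaV l → Fin m // ∀ u v, u ≠ v → ¬ C.H.Adj (u, c u) (v, c v)} := fun q =>
    ⟨thetaColoring q.1.1 q.1.2 fun i => (q.2 i).1, by
      have key : ∀ (i : Fin n) (j : ℕ), j < l i - 1 + 1 → ¬ C.H.Adj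
          (thetaPath l i j, thetaColoring q.1.1 q.1.2 (fun i => (q.2 i).1) (thetaPath l i j))
          (thetaPath l i (j + 1),
            thetaColoring q.1.1 q.1.2 (fun i => (q.2 i).1) (thetaPath l i (j + 1))) := by
        intro i j hj hadj
        have h := hs i j hj _ _ hadj
        rw [thetaColoring_thetaPath, thetaColoring_thetaPath] at h
        exact (q.2 i).2 j hj h
      have hrel : ∀ u v, u ≠ v → thetaRel l u v → ¬ C.H.Adj
          (u, thetaColoring q.1.1 q.1.2 (fun i => (q.2 i).1) u)
          (v, thetaColoring q.1.1 q.1.2 (fun i => (q.2 i).1) v) := by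
        intro u v huv h hadj
        obtain ⟨i, j, hj, ⟨rfl, rfl⟩ | ⟨rfl, rfl⟩⟩ := exists_thetaPath_of_thetaRel huv h
        · exact key i j hj hadj
        · exact key i j hj hadj.symm
      intro u v huv hadj
      rcases (C.cross_only_edges u v _ _ huv hadj).2 with h | h
      · exact hrel u v huv h hadj
      · exact hrel v u huv.symm h hadj.symm⟩
  have hf : Function.Injective f := by
    rintro ⟨⟨a, b⟩, x⟩ ⟨⟨a', b'⟩, x'⟩ h
    have h' : ∀ v, thetaColoring a b (fun i => (x i).1) v =
        thetaColoring a' b' (fun i => (x' i).1) v := congrFun (congrArg Subtype.val h)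
    obtain rfl : a = a' := h' (Sum.inl false)
    obtain rfl : b = b' := h' (Sum.inl true)
    have : x = x' := funext fun i => Subtype.ext (funext fun j => h' (Sum.inr ⟨i, j⟩))
    rw [this]
  have := Nat.card_le_card_of_injective f hf
  simp only [Nat.card_sigma, Nat.card_pi] at this
  exact this

theorem prod_rpow_ite_perm {m : ℕ} (hm : 0 < m) (τ : Equiv.Perm (Fin m)) {A B : ℝ} (hA : 0 ≤ A)
    (hB : 0 < B) :
    ∏ p : Fin m × Fin m, (if p.2 = τ p.1 then A else B) ^ ((1 : ℝ) / (m : ℝ) ^ 2) =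
      (A / B) ^ ((1 : ℝ) / m) * B := by
  have hm0 : (m : ℝ) ≠ 0 := by positivity
  have hterm : ∀ a b : Fin m, (if b = τ a then A else B) ^ ((1 : ℝ) / (m : ℝ) ^ 2) =
      (if b = τ a then (A / B) ^ ((1 : ℝ) / (m : ℝ) ^ 2) else 1) *
        B ^ ((1 : ℝ) / (m : ℝ) ^ 2) := by
    intro a b
    split_ifs
    · rw [← Real.mul_rpow (by positivity) hB.le, div_mul_cancel₀ _ hB.ne']
    · rw [one_mul]
  rw [Fintype.prod_prod_type]
  simp only [hterm, Finset.prod_mul_distrib, Finset.prod_ite_eq', Finset.mem_univ, if_true,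
    Finset.prod_const, Finset.card_univ, Fintype.card_fin]
  rw [← pow_mul, ← Real.rpow_mul_natCast (by positivity), ← Real.rpow_mul_natCast hB.le]
  congr 1
  · congr 1; field_simp
  · rw [show (1 : ℝ) / (m : ℝ) ^ 2 * (m * m : ℕ) = 1 by push_cast; field_simp, Real.rpow_one]

theorem geom_bound_le_count {n m : ℕ} (l : Fin n → ℕ) (hl : ∀ i, 1 ≤ l i) (hm : 3 ≤ m)
    (C : DPCover (thetaGraph l) m) :
    (m : ℝ) ^ 2 * ∏ i : Fin n,
        (((((m : ℝ) - 1) ^ (l i) + (-1 : ℝ) ^ (l i) * ((m : ℝ) - 1)) /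
            (((m : ℝ) - 1) ^ (l i) - (-1 : ℝ) ^ (l i))) ^ ((1 : ℝ) / m) *
          ((((m : ℝ) - 1) ^ (l i) - (-1 : ℝ) ^ (l i)) / m)) ≤ C.count := by
  have hm3 : (3 : ℝ) ≤ m := by exact_mod_cast hm
  have hmpos : (0 : ℝ) < m := by linarith
  have hq : ∀ i, (m : ℝ) - 1 ≤ ((m : ℝ) - 1) ^ l i := fun i =>
    le_self_pow₀ (by linarith) (by have := hl i; omega)
  have hA : ∀ i, 0 ≤ (((m : ℝ) - 1) ^ (l i) + (-1 : ℝ) ^ (l i) * ((m : ℝ) - 1)) / m := by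
    intro i
    have := hq i
    refine div_nonneg ?_ hmpos.le
    rcases neg_one_pow_eq_or ℝ (l i) with h | h <;> rw [h] <;> linarith
  have hB : ∀ i, 0 < (((m : ℝ) - 1) ^ (l i) - (-1 : ℝ) ^ (l i)) / m := by
    intro i
    have := hq i
    refine div_pos ?_ hmpos
    rcases neg_one_pow_eq_or ℝ (l i) with h | h <;> rw [h] <;> linarith
  obtain ⟨s, hs⟩ := exists_perm_sum_prod_le_count l C
  choose τ hτ using fun i => exists_perm_card_pathColoring (by omega : 0 < m) (l i - 1) (s i)
  simp only [Nat.sub_add_cancel (hl _)] at hτ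
  have hcount : ∑ p : Fin m × Fin m, ∏ i, (Nat.card (PathColoring (l i - 1) (s i) p.1 p.2) : ℝ)
      ≤ C.count := by exact_mod_cast hs
  have hamgm := Real.geom_mean_le_arith_mean_weighted (univ : Finset (Fin m × Fin m))
    (fun _ => (1 : ℝ) / (m : ℝ) ^ 2)
    (fun p => ∏ i, (Nat.card (PathColoring (l i - 1) (s i) p.1 p.2) : ℝ))
    (fun _ _ => by positivity) (by simp; field_simp)
    (fun _ _ => Finset.prod_nonneg fun _ _ => Nat.cast_nonneg _)
  have hprod : ∏ p : Fin m × Fin m,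
      (∏ i, (Nat.card (PathColoring (l i - 1) (s i) p.1 p.2) : ℝ)) ^ ((1 : ℝ) / (m : ℝ) ^ 2) =
      ∏ i : Fin n,
        (((((m : ℝ) - 1) ^ (l i) + (-1 : ℝ) ^ (l i) * ((m : ℝ) - 1)) /
            (((m : ℝ) - 1) ^ (l i) - (-1 : ℝ) ^ (l i))) ^ ((1 : ℝ) / m) *
          ((((m : ℝ) - 1) ^ (l i) - (-1 : ℝ) ^ (l i)) / m)) := by
    have : ∀ p : Fin m × Fin m,
        (∏ i, (Nat.card (PathColoring (l i - 1) (s i) p.1 p.2) : ℝ)) ^ ((1 : ℝ) / (m : ℝ) ^ 2) =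
        ∏ i, (Nat.card (PathColoring (l i - 1) (s i) p.1 p.2) : ℝ) ^ ((1 : ℝ) / (m : ℝ) ^ 2) :=
      fun p => (Real.finsetProd_rpow _ _ (fun _ _ => Nat.cast_nonneg _) _).symm
    simp only [this]
    rw [Finset.prod_comm]
    refine Finset.prod_congr rfl fun i _ => ?_
    simp only [hτ]
    rw [prod_rpow_ite_perm (by omega) (τ i) (hA i) (hB i), div_div_div_cancel_right₀ hmpos.ne']
  rw [hprod, ← Finset.mul_sum] at hamgm
  refine le_trans ?_ hcount
  rwa [one_div_mul_eq_div, le_div_iff₀' (by positivity)] at hamgm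

/-- The cover whose colorings are the proper `m`-colorings of `G`. -/
def canonicalDPCover {V : Type*} (G : SimpleGraph V) (m : ℕ) : DPCover G m where
  H :=
    { Adj := fun p q => (p.1 = q.1 ∧ p.2 ≠ q.2) ∨ (G.Adj p.1 q.1 ∧ p.2 = q.2)
      symm := ⟨by
        rintro p q (⟨h, h'⟩ | ⟨h, h'⟩)
        · exact Or.inl ⟨h.symm, h'.symm⟩
        · exact Or.inr ⟨h.symm, h'.symm⟩⟩
      loopless := ⟨by
        rintro p (⟨_, h⟩ | ⟨h, _⟩)
        · exact h rfl
        · exact G.loopless.irrefl _ h⟩ }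
  fiber_clique _ _ _ h := Or.inl ⟨rfl, h⟩
  cross_only_edges _ _ _ _ huv h := h.elim (fun h => absurd h.1 huv) fun h => h.1
  cross_matching _ _ huv _ _ _ h h' :=
    (h.elim (fun h => absurd h.1 huv) fun h => h.2.symm).trans
      (h'.elim (fun h => absurd h.1 huv) fun h => h.2)

theorem canonicalDPCover_count {V : Type*} (G : SimpleGraph V) (m : ℕ) :
    (canonicalDPCover G m).count = chromP G m := by
  refine Nat.card_congr (Equiv.subtypeEquivRight fun c => ⟨fun h u v huv heq => ?_, ?_⟩)
  · exact h u v huv.ne (Or.inr ⟨huv, heq⟩)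
  · rintro h u v huv (⟨h', _⟩ | ⟨h', heq⟩)
    · exact huv h'
    · exact h u v h' heq

theorem PDP_le_chromP {V : Type*} (G : SimpleGraph V) (m : ℕ) : PDP G m ≤ chromP G m :=
  Nat.sInf_le ⟨canonicalDPCover G m, canonicalDPCover_count G m⟩

/-- Let `G = Θ(l_1, …, l_n)`.  For any `m ≥ 3`, if
`P(G,m) = ⌈ m² · Π_{i=1}^{n} ( (((m−1)^{l_i} + (−1)^{l_i}(m−1)) / ((m−1)^{l_i} − (−1)^{l_i}))^{1/m}
· ((m−1)^{l_i} − (−1)^{l_i})/m ) ⌉`, then `P_DP(G,m) = P(G,m)`. -/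
theorem statement2 {n : ℕ} (hn : 2 ≤ n) (l : Fin n → ℕ)
    (hmin : ∀ i : Fin n, l ⟨0, by omega⟩ ≤ l i)
    (hl1 : 1 ≤ l ⟨0, by omega⟩)
    (hli : ∀ i : Fin n, i ≠ ⟨0, by omega⟩ → 2 ≤ l i)
    (m : ℕ) (hm : 3 ≤ m)
    (h : (chromP (thetaGraph l) m : ℤ) =
      ⌈(m : ℝ) ^ 2 * ∏ i : Fin n,
        (((((m : ℝ) - 1) ^ (l i) + (-1 : ℝ) ^ (l i) * ((m : ℝ) - 1)) /
            (((m : ℝ) - 1) ^ (l i) - (-1 : ℝ) ^ (l i))) ^ ((1 : ℝ) / m) *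
          ((((m : ℝ) - 1) ^ (l i) - (-1 : ℝ) ^ (l i)) / m))⌉) :
    PDP (thetaGraph l) m = chromP (thetaGraph l) m := by
  have hl : ∀ i, 1 ≤ l i := fun i => hl1.trans (hmin i)
  refine le_antisymm (PDP_le_chromP _ _) ?_
  obtain ⟨C, hC⟩ := Nat.sInf_mem (Set.range_nonempty_iff_nonempty.mpr
    ⟨canonicalDPCover (thetaGraph l) m⟩ : (Set.range fun C : DPCover (thetaGraph l) m =>
      C.count).Nonempty)
  have hle : (chromP (thetaGraph l) m : ℤ) ≤ (C.count : ℤ) := by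
    rw [h, Int.ceil_le]
    exact_mod_cast geom_bound_le_count l hl hm C
  calc chromP (thetaGraph l) m ≤ C.count := by exact_mod_cast hle
    _ = PDP (thetaGraph l) m := hC
end

section
/- Let G = Θ(2,3,3,3,2). Then P_DP(G,3) = P(G,3), and there exists N ∈ ℕ such that P_DP(G,m) < P(G,m) for all m ≥ N. -/
open Finset

/-- Functions `c : V → X` avoiding, along each pair `u v` related by `r`, the colour
`ρ u v (c u)` at `v`. -/
def TwistedColoring {V X : Type*} (r : V → V → Prop) (ρ : V → V → Equiv.Perm X) : Type _ :=
  {c : V → X // ∀ u v, r u v → ρ u v (c u) ≠ c v}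

/-- The cover of `SimpleGraph.fromRel r` given by a permutation on each pair related by `r`. -/
def DPCover.ofPerm {V : Type*} {m : ℕ} (r : V → V → Prop) (hr : ∀ u v, r u v → ¬ r v u)
    (ρ : V → V → Equiv.Perm (Fin m)) : DPCover (SimpleGraph.fromRel r) m where
  H :=
    { Adj := fun p q => (p.1 = q.1 ∧ p.2 ≠ q.2) ∨ (r p.1 q.1 ∧ ρ p.1 q.1 p.2 = q.2) ∨
        (r q.1 p.1 ∧ ρ q.1 p.1 q.2 = p.2)
      symm := ⟨by
        rintro p q (⟨h, h'⟩ | h | h)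
        · exact Or.inl ⟨h.symm, h'.symm⟩
        · exact Or.inr (Or.inr h)
        · exact Or.inr (Or.inl h)⟩
      loopless := ⟨by
        rintro p (⟨_, h⟩ | ⟨h, _⟩ | ⟨h, _⟩)
        · exact h rfl
        · exact hr _ _ h h
        · exact hr _ _ h h⟩ }
  fiber_clique := fun _ _ _ h => Or.inl ⟨rfl, h⟩
  cross_only_edges := by
    rintro u v a b huv (⟨h, _⟩ | ⟨h, _⟩ | ⟨h, _⟩)
    · exact absurd h huv
    · exact ⟨huv, Or.inl h⟩
    · exact ⟨huv, Or.inr h⟩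
  cross_matching := by
    rintro u v huv a b b' (⟨h, _⟩ | ⟨h, e⟩ | ⟨h, e⟩) (⟨h', _⟩ | ⟨h', e'⟩ | ⟨h', e'⟩)
    all_goals first
      | exact absurd h huv
      | exact absurd h' huv
      | exact absurd h' (hr _ _ h)
      | exact e.symm.trans e'
      | exact (ρ v u).injective (e.trans e'.symm)

theorem DPCover.count_ofPerm {V : Type*} {m : ℕ} (r : V → V → Prop)
    (hr : ∀ u v, r u v → ¬ r v u) (ρ : V → V → Equiv.Perm (Fin m)) :
    (DPCover.ofPerm r hr ρ).count = Nat.card (TwistedColoring r ρ) := by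
  refine Nat.card_congr (Equiv.subtypeEquivRight fun c => ?_)
  constructor
  · intro h u v huv e
    refine h u v ?_ (Or.inr (Or.inl ⟨huv, e⟩))
    rintro rfl
    exact hr _ _ huv huv
  · rintro h u v huv (⟨e, _⟩ | ⟨e, e'⟩ | ⟨e, e'⟩)
    · exact huv e
    · exact h _ _ e e'
    · exact h _ _ e e'

theorem chromP_fromRel {V : Type*} {m : ℕ} (r : V → V → Prop) (hr : ∀ u v, r u v → ¬ r v u) :
    chromP (SimpleGraph.fromRel r) m =
      Nat.card (TwistedColoring r fun _ _ => (1 : Equiv.Perm (Fin m))) := by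
  refine Nat.card_congr (Equiv.subtypeEquivRight fun c => ?_)
  constructor
  · intro h u v huv
    refine h u v ⟨?_, Or.inl huv⟩
    rintro rfl
    exact hr _ _ huv huv
  · rintro h u v ⟨_, e | e⟩
    · exact h _ _ e
    · exact (h _ _ e).symm

theorem exists_perm_of_partial_matching {α : Type*} [Finite α] (R : α → α → Prop)
    (h₁ : ∀ a b b', R a b → R a b' → b = b') (h₂ : ∀ a a' b, R a b → R a' b → a = a') :
    ∃ σ : Equiv.Perm α, ∀ a b, R a b → σ a = b := by
  classical
  have := Fintype.ofFinite α
  let f : α → α := fun a => if h : ∃ b, R a b then h.choose else a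
  have hf : ∀ a b, R a b → f a = b := by
    intro a b hab
    have h : ∃ b, R a b := ⟨b, hab⟩
    simp only [f, dif_pos h]
    exact h₁ a _ _ h.choose_spec hab
  obtain ⟨g, hg⟩ := Finset.exists_equiv_extend_of_card_eq (α := α) (β := α) (t := univ)
    (by simp) (s := univ.filter fun a => ∃ b, R a b) (f := f) (by simp) (by
      rintro a ha a' ha' e
      simp only [coe_filter, mem_univ, true_and, Set.mem_ofPred_eq] at ha ha'
      obtain ⟨b, hb⟩ := ha
      obtain ⟨b', hb'⟩ := ha'
      rw [hf a b hb, hf a' b' hb'] at e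
      subst e
      exact h₂ _ _ _ hb hb')
  refine ⟨g.trans (Equiv.subtypeUnivEquiv fun _ => mem_univ _), fun a b hab => ?_⟩
  have := hg a (by simpa using ⟨b, hab⟩)
  simpa [hf a b hab] using this

theorem DPCover.exists_twistedColoring_le_count {V : Type*} [Finite V] {m : ℕ}
    (r : V → V → Prop) (C : DPCover (SimpleGraph.fromRel r) m) :
    ∃ ρ : V → V → Equiv.Perm (Fin m), Nat.card (TwistedColoring r ρ) ≤ C.count := by
  have key : ∀ u v : V, ∃ σ : Equiv.Perm (Fin m),
      u ≠ v → ∀ a b, C.H.Adj (u, a) (v, b) → σ a = b := by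
    intro u v
    by_cases huv : u = v
    · exact ⟨1, fun h => absurd huv h⟩
    obtain ⟨σ, hσ⟩ := exists_perm_of_partial_matching (fun a b => C.H.Adj (u, a) (v, b))
      (fun a b b' => C.cross_matching u v huv a b b')
      (fun a a' b h h' => C.cross_matching v u (Ne.symm huv) b a a' h.symm h'.symm)
    exact ⟨σ, fun _ => hσ⟩
  choose ρ hρ using key
  refine ⟨ρ, ?_⟩
  refine Nat.card_le_card_of_injective (fun c => ⟨c.1, fun u v huv hadj => ?_⟩)
    fun c c' h => Subtype.ext ?_
  · rcases (C.cross_only_edges u v _ _ huv hadj).2 with h | h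
    · exact c.2 u v h (hρ u v huv _ _ hadj)
    · exact c.2 v u h (hρ v u huv.symm _ _ hadj.symm)
  · simpa using h

/-- Number of ways to colour the interior of a path of length `k` whose ends are coloured
`a` and `b`, where the edges carry the permutations `α` (first), `β` (last), `τ` (interior). -/
noncomputable def pathCount {X : Type*} (k : ℕ) (α β : Fin (k - 1) → Equiv.Perm X)
    (τ : Fin (k - 1) → Fin (k - 1) → Equiv.Perm X) (a b : X) : ℕ :=
  Nat.card {x : Fin (k - 1) → X // (∀ j : Fin (k - 1), (j : ℕ) = 0 → α j a ≠ x j) ∧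
    (∀ j : Fin (k - 1), (j : ℕ) = k - 2 → β j b ≠ x j) ∧
    ∀ j j' : Fin (k - 1), (j' : ℕ) = (j : ℕ) + 1 → τ j j' (x j) ≠ x j'}

theorem card_twistedColoring_theta {X : Type*} [Fintype X] {n : ℕ} (l : Fin n → ℕ)
    (hl : ∀ i, l i ≠ 1) (ρ : ThetaV l → ThetaV l → Equiv.Perm X) :
    Nat.card (TwistedColoring (thetaRel l) ρ) =
      ∑ a, ∑ b, ∏ i, pathCount (l i) (fun j => ρ (Sum.inl false) (Sum.inr ⟨i, j⟩))
        (fun j => ρ (Sum.inl true) (Sum.inr ⟨i, j⟩))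
        (fun j j' => ρ (Sum.inr ⟨i, j⟩) (Sum.inr ⟨i, j'⟩)) a b := by
  let P : (p : X × X) → (i : Fin n) → (Fin (l i - 1) → X) → Prop := fun p i x =>
    (∀ j : Fin (l i - 1), (j : ℕ) = 0 → ρ (Sum.inl false) (Sum.inr ⟨i, j⟩) p.1 ≠ x j) ∧
    (∀ j : Fin (l i - 1), (j : ℕ) = l i - 2 → ρ (Sum.inl true) (Sum.inr ⟨i, j⟩) p.2 ≠ x j) ∧
    ∀ j j' : Fin (l i - 1), (j' : ℕ) = (j : ℕ) + 1 →
      ρ (Sum.inr ⟨i, j⟩) (Sum.inr ⟨i, j'⟩) (x j) ≠ x j'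
  let e : TwistedColoring (thetaRel l) ρ ≃
      (Σ p : X × X, (i : Fin n) → {x : Fin (l i - 1) → X // P p i x}) :=
    { toFun := fun c => ⟨(c.1 (Sum.inl false), c.1 (Sum.inl true)), fun i =>
        ⟨fun j => c.1 (Sum.inr ⟨i, j⟩), fun j hj => c.2 _ _ (Or.inl ⟨rfl, hj⟩),
          fun j hj => c.2 _ _ (Or.inr ⟨rfl, hj⟩), fun j j' hj => c.2 _ _ ⟨rfl, hj⟩⟩⟩
      invFun := fun q => ⟨fun v => match v with
          | Sum.inl false => q.1.1
          | Sum.inl true => q.1.2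
          | Sum.inr ⟨i, j⟩ => (q.2 i).1 j, by
        rintro (u | ⟨i, j⟩) (v | ⟨i', j'⟩) h
        · obtain ⟨i, hi⟩ := h
          exact absurd hi (hl i)
        · rcases h with ⟨rfl, h⟩ | ⟨rfl, h⟩
          · exact (q.2 i').2.1 j' h
          · exact (q.2 i').2.2.1 j' h
        · exact h.elim
        · obtain ⟨rfl, h⟩ := h
          exact (q.2 i).2.2.2 j j' h⟩
      left_inv := by
        intro c
        apply Subtype.ext
        funext v
        rcases v with (_ | _) | ⟨i, j⟩ <;> rfl
      right_inv := fun q => rfl }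
  rw [Nat.card_congr e, Nat.card_sigma, Fintype.sum_prod_type]
  simp only [Nat.card_pi]
  rfl

theorem card_ne_and_ne {X : Type*} [Fintype X] {y : ℕ} (hX : Nat.card X = y + 2)
    [DecidableEq X] (p q : X) :
    Fintype.card {x : X // p ≠ x ∧ q ≠ x} = if p = q then y + 1 else y := by
  rw [Nat.card_eq_fintype_card] at hX
  have : (univ.filter fun x => p ≠ x ∧ q ≠ x) = ({p, q} : Finset X)ᶜ := by
    ext x
    simp [eq_comm]
  rw [Fintype.card_subtype, this, card_compl, hX]
  split_ifs with h
  · simp [h]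
  · rw [card_pair h]
    omega

theorem pathCount_two {X : Type*} [Fintype X] [DecidableEq X] {y : ℕ} (hX : Nat.card X = y + 2)
    (α β : Fin (2 - 1) → Equiv.Perm X) (τ : Fin (2 - 1) → Fin (2 - 1) → Equiv.Perm X) (a b : X) :
    pathCount 2 α β τ a b = if α 0 a = β 0 b then y + 1 else y := by
  rw [← card_ne_and_ne hX, ← Nat.card_eq_fintype_card]
  refine Nat.card_congr ((Equiv.funUnique (Fin 1) X).subtypeEquiv fun x => ?_)
  change ((∀ j : Fin 1, (j : ℕ) = 0 → α j a ≠ x j) ∧ (∀ j : Fin 1, (j : ℕ) = 0 → β j b ≠ x j) ∧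
    ∀ j j' : Fin 1, (j' : ℕ) = (j : ℕ) + 1 → τ j j' (x j) ≠ x j') ↔ α 0 a ≠ x 0 ∧ β 0 b ≠ x 0
  simp

theorem pathCount_three {X : Type*} [Fintype X] [DecidableEq X] {y : ℕ}
    (hX : Nat.card X = y + 2) (α β : Fin (3 - 1) → Equiv.Perm X)
    (τ : Fin (3 - 1) → Fin (3 - 1) → Equiv.Perm X) (a b : X) :
    pathCount 3 α β τ a b =
      if τ 0 1 (α 0 a) = β 1 b then (y + 1) * y else (y + 1) * y + 1 := by
  let e : {x : Fin 2 → X // (∀ j : Fin 2, (j : ℕ) = 0 → α j a ≠ x j) ∧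
      (∀ j : Fin 2, (j : ℕ) = 1 → β j b ≠ x j) ∧
      ∀ j j' : Fin 2, (j' : ℕ) = (j : ℕ) + 1 → τ j j' (x j) ≠ x j'} ≃
      (Σ x : {x : X // x ≠ α 0 a}, {z : X // τ 0 1 x.1 ≠ z ∧ β 1 b ≠ z}) :=
    { toFun := fun x => ⟨⟨x.1 0, (x.2.1 0 rfl).symm⟩, x.1 1, x.2.2.2 0 1 rfl, x.2.2.1 1 rfl⟩
      invFun := fun q => ⟨![q.1.1, q.2.1], by
        have h1 := q.1.2
        have h2 := q.2.2
        simp [Fin.forall_fin_two, h1.symm, h2.1, h2.2]⟩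
      left_inv := by
        intro x
        apply Subtype.ext
        funext j
        fin_cases j <;> rfl
      right_inv := fun q => rfl }
  have h1 : Fintype.card {x : X // x ≠ α 0 a} = y + 1 := by
    rw [Nat.card_eq_fintype_card] at hX
    rw [Fintype.card_subtype_compl, hX]
    simp
  have h2 : pathCount 3 α β τ a b =
      ∑ x : {x : X // x ≠ α 0 a}, (y + if τ 0 1 x.1 = β 1 b then 1 else 0) := by
    refine (Nat.card_congr e).trans ?_
    rw [Nat.card_sigma]
    refine sum_congr rfl fun x _ => ?_
    rw [Nat.card_eq_fintype_card, card_ne_and_ne hX]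
    split_ifs <;> rfl
  rw [h2, sum_add_distrib, sum_const, card_univ, h1, smul_eq_mul, sum_boole]
  split_ifs with h
  · rw [filter_false_of_mem]
    · simp
    · rintro ⟨x, hx⟩ _ hx'
      exact hx ((τ 0 1).injective (hx'.trans h.symm))
  · have : (univ.filter fun x : {x : X // x ≠ α 0 a} => τ 0 1 x.1 = β 1 b) =
        {⟨(τ 0 1).symm (β 1 b), fun h' => h (by rw [← h']; simp)⟩} := by
      ext x
      simp only [mem_filter, mem_univ, true_and, mem_singleton]
      rw [Subtype.ext_iff, Equiv.eq_symm_apply]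
    rw [this]
    simp

theorem theta_length_ne_one : ∀ i, (![2, 3, 3, 3, 2] : Fin 5 → ℕ) i ≠ 1 := by decide

theorem thetaRel_asymm {n : ℕ} (l : Fin n → ℕ) (hl : ∀ i, l i ≠ 1) (u v : ThetaV l) :
    thetaRel l u v → ¬ thetaRel l v u := by
  rcases u with u | ⟨i, j⟩ <;> rcases v with v | ⟨i', j'⟩ <;> intro h h'
  · obtain ⟨i, hi⟩ := h
    exact hl i hi
  · exact h'
  · exact h
  · have h1 := h.2
    have h2 := h'.2
    omega

theorem card_twistedColoring_theta23332 {X : Type*} [Fintype X] [DecidableEq X] {y : ℕ}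
    (hX : Nat.card X = y + 2)
    (ρ : ThetaV ![2, 3, 3, 3, 2] → ThetaV ![2, 3, 3, 3, 2] → Equiv.Perm X) :
    Nat.card (TwistedColoring (thetaRel ![2, 3, 3, 3, 2]) ρ) = ∑ a, ∑ b,
      (if ρ (Sum.inl false) (Sum.inr ⟨0, (0 : Fin 1)⟩) a =
          ρ (Sum.inl true) (Sum.inr ⟨0, (0 : Fin 1)⟩) b then y + 1 else y) *
      (if ρ (Sum.inr ⟨1, (0 : Fin 2)⟩) (Sum.inr ⟨1, (1 : Fin 2)⟩)
          (ρ (Sum.inl false) (Sum.inr ⟨1, (0 : Fin 2)⟩) a) =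
          ρ (Sum.inl true) (Sum.inr ⟨1, (1 : Fin 2)⟩) b then (y + 1) * y else (y + 1) * y + 1) *
      (if ρ (Sum.inr ⟨2, (0 : Fin 2)⟩) (Sum.inr ⟨2, (1 : Fin 2)⟩)
          (ρ (Sum.inl false) (Sum.inr ⟨2, (0 : Fin 2)⟩) a) =
          ρ (Sum.inl true) (Sum.inr ⟨2, (1 : Fin 2)⟩) b then (y + 1) * y else (y + 1) * y + 1) *
      (if ρ (Sum.inr ⟨3, (0 : Fin 2)⟩) (Sum.inr ⟨3, (1 : Fin 2)⟩)
          (ρ (Sum.inl false) (Sum.inr ⟨3, (0 : Fin 2)⟩) a) =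
          ρ (Sum.inl true) (Sum.inr ⟨3, (1 : Fin 2)⟩) b then (y + 1) * y else (y + 1) * y + 1) *
      (if ρ (Sum.inl false) (Sum.inr ⟨4, (0 : Fin 1)⟩) a =
          ρ (Sum.inl true) (Sum.inr ⟨4, (0 : Fin 1)⟩) b then y + 1 else y) := by
  rw [card_twistedColoring_theta _ theta_length_ne_one]
  refine sum_congr rfl fun a _ => sum_congr rfl fun b _ => ?_
  rw [Fin.prod_univ_five]
  congr 1
  · congr 1
    · congr 1
      · congr 1
        · exact pathCount_two hX _ _ _ a b
        · exact pathCount_three hX _ _ _ a b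
      · exact pathCount_three hX _ _ _ a b
    · exact pathCount_three hX _ _ _ a b
  · exact pathCount_two hX _ _ _ a b

theorem le_row_sum_three : ∀ p₀ p₁ p₂ p₃ p₄ : Fin 3, 86 ≤ ∑ b : Fin 3,
    (if p₀ = b then 1 + 1 else 1) * (if p₁ = b then (1 + 1) * 1 else (1 + 1) * 1 + 1) *
    (if p₂ = b then (1 + 1) * 1 else (1 + 1) * 1 + 1) *
    (if p₃ = b then (1 + 1) * 1 else (1 + 1) * 1 + 1) * (if p₄ = b then 1 + 1 else 1) := by
  decide +kernel

theorem two_hundred_fifty_eight_le_card_twistedColoring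
    (ρ : ThetaV ![2, 3, 3, 3, 2] → ThetaV ![2, 3, 3, 3, 2] → Equiv.Perm (Fin 3)) :
    258 ≤ Nat.card (TwistedColoring (thetaRel ![2, 3, 3, 3, 2]) ρ) := by
  rw [card_twistedColoring_theta23332 (y := 1) (by simp)]
  have : (258 : ℕ) = ∑ _a : Fin 3, 86 := by simp
  rw [this]
  refine sum_le_sum fun a _ => ?_
  simp only [← Equiv.symm_apply_eq (ρ (Sum.inl true) _)]
  exact le_row_sum_three _ _ _ _ _

theorem chromP_theta_three : chromP (thetaGraph ![2, 3, 3, 3, 2]) 3 = 258 := by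
  rw [thetaGraph, chromP_fromRel _ (thetaRel_asymm _ theta_length_ne_one),
    card_twistedColoring_theta23332 (y := 1) (by simp)]
  simp only [Equiv.Perm.one_apply]
  decide +kernel

theorem PDP_theta_lt_chromP (m : ℕ) (hm : 4 ≤ m) :
    PDP (thetaGraph ![2, 3, 3, 3, 2]) m < chromP (thetaGraph ![2, 3, 3, 3, 2]) m := by
  obtain ⟨k, rfl⟩ : ∃ k, m = k + 4 := ⟨m - 4, by omega⟩
  have hr := thetaRel_asymm ![2, 3, 3, 3, 2] theta_length_ne_one
  let ρ : ThetaV ![2, 3, 3, 3, 2] → ThetaV ![2, 3, 3, 3, 2] → Equiv.Perm (Fin (k + 4)) :=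
    fun u v => match u, v with
      | Sum.inl false, Sum.inr ⟨i, _⟩ => if 3 ≤ i then finRotate (k + 4) else 1
      | _, _ => 1
  refine lt_of_le_of_lt (Nat.sInf_le ⟨DPCover.ofPerm _ hr ρ, rfl⟩) ?_
  change (DPCover.ofPerm _ hr ρ).count < _
  rw [DPCover.count_ofPerm, thetaGraph, chromP_fromRel _ hr,
    card_twistedColoring_theta23332 (y := k + 2) (by simp),
    card_twistedColoring_theta23332 (y := k + 2) (by simp)]
  refine sum_lt_sum_of_nonempty univ_nonempty fun a _ => ?_
  have h3 : ¬ ((3 : Fin 5) ≤ 0) ∧ ¬ ((3 : Fin 5) ≤ 1) ∧ ¬ ((3 : Fin 5) ≤ 2) ∧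
    ((3 : Fin 5) ≤ 4) := by decide
  have hs : a ≠ finRotate (k + 4) a := by
    rw [finRotate_apply]
    simp
  simp only [ρ, h3, if_false, if_true, le_refl, Equiv.Perm.one_apply]
  generalize finRotate (k + 4) a = s at hs
  rw [← add_sum_erase _ _ (mem_univ a), ← add_sum_erase (univ : Finset (Fin (k + 4))) _ (mem_univ a),
    ← add_sum_erase _ _ (mem_erase.2 ⟨hs.symm, mem_univ s⟩),
    ← add_sum_erase (univ.erase a) _ (mem_erase.2 ⟨hs.symm, mem_univ s⟩), ← add_assoc, ← add_assoc]
  refine add_lt_add_of_lt_of_le ?_ (sum_le_sum fun b hb => ?_)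
  · simp only [hs, hs.symm, if_false, if_true]
    have h : 0 < (k + 2) ^ 3 * (k ^ 3 + 6 * k ^ 2 + 11 * k + 5) := by positivity
    nlinarith [h]
  · simp only [mem_erase] at hb
    simp [hb.1.symm, hb.2.1.symm]

/-- Let `G = Θ(2,3,3,3,2)`.  Then `P_DP(G,3) = P(G,3)`, and there exists
`N ∈ ℕ` such that `P_DP(G,m) < P(G,m)` for all `m ≥ N`. -/
theorem statement3 :
    PDP (thetaGraph ![2, 3, 3, 3, 2]) 3 = chromP (thetaGraph ![2, 3, 3, 3, 2]) 3 ∧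
    ∃ N : ℕ, ∀ m : ℕ, N ≤ m →
      PDP (thetaGraph ![2, 3, 3, 3, 2]) m < chromP (thetaGraph ![2, 3, 3, 3, 2]) m := by
  have hr := thetaRel_asymm ![2, 3, 3, 3, 2] theta_length_ne_one
  refine ⟨le_antisymm ?_ ?_, 4, PDP_theta_lt_chromP⟩
  · refine (Nat.sInf_le (Set.mem_range_self (DPCover.ofPerm _ hr fun _ _ => 1))).trans_eq ?_
    exact (DPCover.count_ofPerm _ hr _).trans (chromP_fromRel _ hr).symm
  · rw [chromP_theta_three]
    refine le_csInf (Set.range_nonempty_iff_nonempty.2 ⟨DPCover.ofPerm _ hr fun _ _ => 1⟩) ?_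
    rintro _ ⟨C, rfl⟩
    obtain ⟨ρ, hρ⟩ := DPCover.exists_twistedColoring_le_count _ C
    exact (two_hundred_fifty_eight_le_card_twistedColoring ρ).trans hρ
end

section
/- Let m ≥ 3 and suppose x_{i,j} is a non-negative integer for each i ∈ [3] and j ∈ [m²]. For each i ∈ [3], suppose there is n_i ≥ 0 with n_i = x_{i,1} = ⋯ = x_{i,m} ≤ x_{i,m+1} = ⋯ = x_{i,m(m−1)} ≤ x_{i,m(m−1)+1} = ⋯ = x_{i,m²} = n_i + 1, and suppose n_1 ≤ n_2 and n_1 ≤ n_3. Let N = |{j ∈ [m²] : x_{1,j} = n_1}| and assume N ∈ {m, m(m−1)}. Let f be the permutation of [m²] given by f(j) = m² + 1 − j, and let g be the permutation of [m²] given by g(j) = m² + j − N if j ∈ [N] and g(j) = j − N otherwise. Then for any permutations σ_1 and σ_2 of [m²]: Σ_{j=1}^{m²} x_{1,j} x_{2,f(j)} x_{3,g(j)} ≤ Σ_{j=1}^{m²} x_{1,j} x_{2,σ_1(j)} x_{3,σ_2(j)}. -/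
open Finset

/-- A sum of products over aligned sequences is minimal as soon as it attains an affine lower bound
on the products of their entries. -/
theorem sum_mul_mul_le_of_affine_bound {ι : Type*} [Fintype ι] (a b c : ι → ℤ)
    (f g σ τ : Equiv.Perm ι) (α β γ δ : ℤ)
    (hle : ∀ i j k, α * a i + β * b j + γ * c k + δ ≤ a i * b j * c k)
    (heq : ∀ j, a j * b (f j) * c (g j) = α * a j + β * b (f j) + γ * c (g j) + δ) :
    ∑ j, a j * b (f j) * c (g j) ≤ ∑ j, a j * b (σ j) * c (τ j) := by
  calc ∑ j, a j * b (f j) * c (g j)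
      = ∑ j, (α * a j + β * b (f j) + γ * c (g j) + δ) := sum_congr rfl fun j _ => heq j
    _ = ∑ j, (α * a j + β * b (σ j) + γ * c (τ j) + δ) := by
        simp only [sum_add_distrib, ← mul_sum, Equiv.sum_comp]
    _ ≤ ∑ j, a j * b (σ j) * c (τ j) := sum_le_sum fun j _ => hle _ _ _

/-- For sequences `p + a`, `q + b`, `r + c` with `a`, `b`, `c` taking values in `{0, 1}`, an
arrangement has minimal sum of products if, at every position, it attains suitable affine lower
bounds for `ab + bc + ca`, `ac`, `ab` and `abc`. -/
theorem sum_shifted_indicator_mul_le {ι : Type*} [Fintype ι] (a b c : ι → ℤ) (p q r : ℤ)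
    (hp : 0 ≤ p) (hpq : p ≤ q) (hpr : p ≤ r)
    (ha : ∀ j, a j = 0 ∨ a j = 1) (hb : ∀ j, b j = 0 ∨ b j = 1) (hc : ∀ j, c j = 0 ∨ c j = 1)
    (f g σ τ : Equiv.Perm ι) (k l u v w : ℤ)
    (hkl : k = 0 ∧ l = 0 ∨ k = 1 ∧ l = 1 ∨ k = 2 ∧ l = 3)
    (hu : u = 0 ∨ u = 1) (hv : v = 0 ∨ v = 1) (hw : w = 0 ∨ w = 1)
    (hpairs : ∀ j, a j * b (f j) + b (f j) * c (g j) + a j * c (g j) =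
      k * (a j + b (f j) + c (g j)) - l)
    (hac : ∀ j, a j * c (g j) = u * (a j + c (g j) - 1))
    (hab : ∀ j, a j * b (f j) = v * (a j + b (f j) - 1))
    (habc : ∀ j, a j * b (f j) * c (g j) = w * (a j + b (f j) + c (g j) - 2)) :
    ∑ j, (p + a j) * (q + b (f j)) * (r + c (g j)) ≤
      ∑ j, (p + a j) * (q + b (σ j)) * (r + c (τ j)) := by
  have expand (x y z : ℤ) : (p + x) * (q + y) * (r + z) =
      p * q * r + q * r * x + p * r * y + p * q * z + p * (x * y + y * z + x * z) +
        (q - p) * (x * z) + (r - p) * (x * y) + x * y * z := by ring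
  have bound (x y z : ℤ) (hx : x = 0 ∨ x = 1) (hy : y = 0 ∨ y = 1) (hz : z = 0 ∨ z = 1) :
      k * (x + y + z) - l ≤ x * y + y * z + x * z ∧ u * (x + z - 1) ≤ x * z ∧
        v * (x + y - 1) ≤ x * y ∧ w * (x + y + z - 2) ≤ x * y * z := by
    refine ⟨?_, ?_, ?_, ?_⟩
    · rcases hkl with ⟨rfl, rfl⟩ | ⟨rfl, rfl⟩ | ⟨rfl, rfl⟩ <;>
        rcases hx with rfl | rfl <;> rcases hy with rfl | rfl <;> rcases hz with rfl | rfl <;>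
        norm_num
    · rcases hu with rfl | rfl <;> rcases hx with rfl | rfl <;> rcases hz with rfl | rfl <;>
        norm_num
    · rcases hv with rfl | rfl <;> rcases hx with rfl | rfl <;> rcases hy with rfl | rfl <;>
        norm_num
    · rcases hw with rfl | rfl <;> rcases hx with rfl | rfl <;> rcases hy with rfl | rfl <;>
        rcases hz with rfl | rfl <;> norm_num
  set α := q * r + p * k + (q - p) * u + (r - p) * v + w with hα
  set β := p * r + p * k + (r - p) * v + w with hβ
  set γ := p * q + p * k + (q - p) * u + w with hγ
  have affine (x y z : ℤ) : α * (p + x) + β * (q + y) + γ * (r + z) +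
      (p * q * r - α * p - β * q - γ * r - p * l - (q - p) * u - (r - p) * v - 2 * w) =
      p * q * r + q * r * x + p * r * y + p * q * z + p * (k * (x + y + z) - l) +
        (q - p) * (u * (x + z - 1)) + (r - p) * (v * (x + y - 1)) + w * (x + y + z - 2) := by
    rw [hα, hβ, hγ]; ring
  refine sum_mul_mul_le_of_affine_bound (fun j => p + a j) (fun j => q + b j) (fun j => r + c j)
    f g σ τ α β γ
    (p * q * r - α * p - β * q - γ * r - p * l - (q - p) * u - (r - p) * v - 2 * w) ?_ ?_
  · intro i j n
    obtain ⟨h₁, h₂, h₃, h₄⟩ := bound _ _ _ (ha i) (hb j) (hc n)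
    rw [affine, expand]
    have := mul_le_mul_of_nonneg_left h₁ hp
    have := mul_le_mul_of_nonneg_left h₂ (sub_nonneg.2 hpq)
    have := mul_le_mul_of_nonneg_left h₃ (sub_nonneg.2 hpr)
    linarith
  · intro j
    rw [affine, expand, habc, hpairs, hac, hab]

/-- Lemma on rearrangements for three sequences.  Indices `j ∈ [m²]` are
represented by `Fin (m^2)` (so the 1-indexed `j` corresponds to the 0-indexed `j - 1`); the
permutation `f(j) = m² + 1 − j` becomes `(f j : ℕ) = m² - 1 - j`, and the permutation
`g(j) = m² + j − N` for `j ∈ [N]`, `g(j) = j − N` otherwise, becomes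
`(g j : ℕ) = (j + (m² − N)) % m²`. -/
theorem statement8 (m : ℕ) (hm : 3 ≤ m) (x : Fin 3 → Fin (m ^ 2) → ℕ) (nn : Fin 3 → ℕ)
    (hlow : ∀ (i : Fin 3) (j : Fin (m ^ 2)), (j : ℕ) < m → x i j = nn i)
    (hhigh : ∀ (i : Fin 3) (j : Fin (m ^ 2)), m * (m - 1) ≤ (j : ℕ) → x i j = nn i + 1)
    (hmid : ∀ (i : Fin 3) (j j' : Fin (m ^ 2)), m ≤ (j : ℕ) → (j : ℕ) < m * (m - 1) →
      m ≤ (j' : ℕ) → (j' : ℕ) < m * (m - 1) → x i j = x i j')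
    (hmono : ∀ i : Fin 3, Monotone (x i))
    (h12 : nn 0 ≤ nn 1) (h13 : nn 0 ≤ nn 2)
    (N : ℕ)
    (hN : N = (Finset.univ.filter fun j : Fin (m ^ 2) => x 0 j = nn 0).card)
    (hNval : N = m ∨ N = m * (m - 1))
    (f g : Equiv.Perm (Fin (m ^ 2)))
    (hf : ∀ j : Fin (m ^ 2), ((f j : ℕ)) = m ^ 2 - 1 - (j : ℕ))
    (hg : ∀ j : Fin (m ^ 2), ((g j : ℕ)) = ((j : ℕ) + (m ^ 2 - N)) % m ^ 2)
    (σ₁ σ₂ : Equiv.Perm (Fin (m ^ 2))) :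
    ∑ j : Fin (m ^ 2), x 0 j * x 1 (f j) * x 2 (g j) ≤
      ∑ j : Fin (m ^ 2), x 0 j * x 1 (σ₁ j) * x 2 (σ₂ j) := by
  obtain ⟨K, hK⟩ : ∃ K, K = m * (m - 1) := ⟨_, rfl⟩
  have hM : m ^ 2 = K + m := by
    obtain ⟨n, rfl⟩ : ∃ n, m = n + 1 := ⟨m - 1, by omega⟩
    simp only [hK, Nat.add_sub_cancel]; ring
  have hK2 : 2 * m ≤ K := by
    rw [hK, mul_comm]; exact Nat.mul_le_mul_left m (by omega)
  rw [← hK] at hNval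
  simp only [← hK] at hhigh hmid
  have threshold (i : Fin 3) : ∃ T, (T = m ∨ T = K) ∧
      ∀ j, x i j = nn i + if T ≤ (j : ℕ) then 1 else 0 := by
    have h₀ := hlow i ⟨0, by omega⟩ (by simp; omega)
    have h₁ := hhigh i ⟨K, by omega⟩ le_rfl
    have h₂ : x i ⟨0, by omega⟩ ≤ x i ⟨m, by omega⟩ := hmono i (by simp)
    have h₃ : x i ⟨m, by omega⟩ ≤ x i ⟨K, by omega⟩ := hmono i (by simp; omega)
    have hx (j : Fin (m ^ 2)) : (j : ℕ) < m ∧ x i j = nn i ∨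
        (m ≤ (j : ℕ) ∧ (j : ℕ) < K) ∧ x i j = x i ⟨m, by omega⟩ ∨
        K ≤ (j : ℕ) ∧ x i j = nn i + 1 := by
      rcases lt_or_ge (j : ℕ) m with h | h
      · exact .inl ⟨h, hlow i j h⟩
      rcases lt_or_ge (j : ℕ) K with h' | h'
      · exact .inr (.inl ⟨⟨h, h'⟩, hmid i j _ h h' le_rfl (by simp; omega)⟩)
      · exact .inr (.inr ⟨h', hhigh i j h'⟩)
    have hmid_value : x i ⟨m, by omega⟩ = nn i + 1 ∨ x i ⟨m, by omega⟩ = nn i := by omega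
    rcases hmid_value with h | h
    · refine ⟨m, .inl rfl, fun j => ?_⟩
      have := hx j
      split_ifs <;> omega
    · refine ⟨K, .inr rfl, fun j => ?_⟩
      have := hx j
      split_ifs <;> omega
  obtain ⟨A, hA, hxA⟩ := threshold 0
  obtain ⟨B, hB, hxB⟩ := threshold 1
  obtain ⟨C, hC, hxC⟩ := threshold 2
  obtain rfl : N = A := by
    have : (univ.filter fun j : Fin (m ^ 2) => x 0 j = nn 0) =
        univ.filter fun j : Fin (m ^ 2) => (j : ℕ) < A := by
      ext j
      simp [hxA]
    rw [hN, this, Fin.card_filter_val_lt]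
    omega
  have hg' (j : Fin (m ^ 2)) : (j : ℕ) < N ∧ (g j : ℕ) = j + (m ^ 2 - N) ∨
      N ≤ (j : ℕ) ∧ (g j : ℕ) = j - N := by
    have hj := j.isLt
    rw [hg]
    rcases lt_or_ge (j : ℕ) N with h | h
    · exact .inl ⟨h, Nat.mod_eq_of_lt (by omega)⟩
    · refine .inr ⟨h, ?_⟩
      rw [show (j : ℕ) + (m ^ 2 - N) = (j - N) + m ^ 2 by omega, Nat.add_mod_right,
        Nat.mod_eq_of_lt (by omega)]
  have key := sum_shifted_indicator_mul_le
    (fun j : Fin (m ^ 2) => if N ≤ (j : ℕ) then (1 : ℤ) else 0)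
    (fun j => if B ≤ (j : ℕ) then 1 else 0) (fun j => if C ≤ (j : ℕ) then 1 else 0)
    (nn 0) (nn 1) (nn 2) (by positivity) (mod_cast h12) (mod_cast h13)
    (fun j => by split_ifs <;> simp) (fun j => by split_ifs <;> simp)
    (fun j => by split_ifs <;> simp) f g σ₁ σ₂
  simp only [hxA, hxB, hxC]
  rw [← Nat.cast_le (α := ℤ)]
  push_cast
  have hj (j : Fin (m ^ 2)) := And.intro j.isLt (And.intro (hf j) (hg' j))
  clear hg' hg hf hxA hxB hxC hlow hhigh hmid hmono threshold hN hK
  rcases hA with rfl | rfl <;> rcases hB with rfl | rfl <;> rcases hC with rfl | rfl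
  · refine key 2 3 1 1 1 (by norm_num) (by norm_num) (by norm_num) (by norm_num)
      ?_ ?_ ?_ ?_ <;> intro j <;> have := hj j <;> split_ifs <;> first | (norm_num; done) | omega
  · refine key 1 1 0 1 0 (by norm_num) (by norm_num) (by norm_num) (by norm_num)
      ?_ ?_ ?_ ?_ <;> intro j <;> have := hj j <;> split_ifs <;> first | (norm_num; done) | omega
  · refine key 1 1 1 0 0 (by norm_num) (by norm_num) (by norm_num) (by norm_num)
      ?_ ?_ ?_ ?_ <;> intro j <;> have := hj j <;> split_ifs <;> first | (norm_num; done) | omega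
  · refine key 1 1 0 0 0 (by norm_num) (by norm_num) (by norm_num) (by norm_num)
      ?_ ?_ ?_ ?_ <;> intro j <;> have := hj j <;> split_ifs <;> first | (norm_num; done) | omega
  · refine key 1 1 0 0 0 (by norm_num) (by norm_num) (by norm_num) (by norm_num)
      ?_ ?_ ?_ ?_ <;> intro j <;> have := hj j <;> split_ifs <;> first | (norm_num; done) | omega
  · refine key 1 1 0 0 0 (by norm_num) (by norm_num) (by norm_num) (by norm_num)
      ?_ ?_ ?_ ?_ <;> intro j <;> have := hj j <;> split_ifs <;> first | (norm_num; done) | omega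
  · refine key 1 1 0 0 0 (by norm_num) (by norm_num) (by norm_num) (by norm_num)
      ?_ ?_ ?_ ?_ <;> intro j <;> have := hj j <;> split_ifs <;> first | (norm_num; done) | omega
  · refine key 0 0 0 0 0 (by norm_num) (by norm_num) (by norm_num) (by norm_num)
      ?_ ?_ ?_ ?_ <;> intro j <;> have := hj j <;> split_ifs <;> first | (norm_num; done) | omega
end
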